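/- For every small coherent category C not equivalent to the terminal category, there exists a positively closed coherent functor M : C ⥤ Type. -/

import Mathlib

open CategoryTheory CategoryTheory.Limits

universe w v u v' u'

namespace PosModel

variable {C : Type u} [Category.{v} C] {D : Type u'} [Category.{v'} D]

/-- A natural transformation is *elementary* if each naturality square at a
monomorphism is a pullback square. -/
def Elementary {N M : C ⥤ D} (η : N ⟶ M) : Prop :=
  ∀ ⦃a x : C⦄ (i : a ⟶ x), Mono i →
    IsPullback (N.map i) (η.app a) (η.app x) (M.map i)

/-- A functor preserves monomorphisms (formulated explicitly). -/
def PreservesMono (F : C ⥤ D) : Prop :=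
  ∀ ⦃X Y : C⦄ (f : X ⟶ Y), Mono f → Mono (F.map f)

/-- The subobject represented by a monomorphism (with an explicit proof of
monicity). -/
noncomputable def mkSub {X A : C} (f : A ⟶ X) (h : Mono f) : Subobject X :=
  haveI := h
  Subobject.mk f

/-- The image of a subobject under a mono-preserving functor. -/
noncomputable def mapSub (F : C ⥤ D) (h : PreservesMono F) {X : C} (a : Subobject X) :
    Subobject (F.obj X) :=
  mkSub (F.map a.arrow) (h a.arrow inferInstance)

/-- The subobject of a functor `M` represented by a pointwise-mono natural
transformation. -/
noncomputable def natSub {N M : C ⥤ D} (α : N ⟶ M) (h : ∀ x : C, Mono (α.app x)) :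
    Subobject M :=
  haveI : ∀ x : C, Mono (α.app x) := h
  haveI : Mono α := NatTrans.mono_of_mono_app α
  Subobject.mk α

/-- The axioms of a *coherent category*: a finitely complete category with
(pullback-stable) effective epi–mono factorizations, binary unions of
subobjects and a least subobject of every object, both stable under pullback. -/
structure CoherentData (C : Type u) [Category.{v} C] [HasFiniteLimits C] :
    Type (max u v) where
  sup : ∀ {X : C}, Subobject X → Subobject X → Subobject X
  le_sup_left : ∀ {X : C} (a b : Subobject X), a ≤ sup a b
  le_sup_right : ∀ {X : C} (a b : Subobject X), b ≤ sup a b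
  sup_le : ∀ {X : C} {a b c : Subobject X}, a ≤ c → b ≤ c → sup a b ≤ c
  bot : ∀ X : C, Subobject X
  bot_le : ∀ {X : C} (a : Subobject X), bot X ≤ a
  factor : ∀ {X Y : C} (f : X ⟶ Y), ∃ (Z : C) (e : X ⟶ Z) (m : Z ⟶ Y),
    EffectiveEpi e ∧ Mono m ∧ e ≫ m = f
  effectiveEpi_pullback : ∀ {P X Y Z : C} (fst : P ⟶ X) (snd : P ⟶ Y) (f : X ⟶ Z) (g : Y ⟶ Z),
    IsPullback fst snd f g → EffectiveEpi g → EffectiveEpi fst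
  sup_pullback : ∀ {X Y : C} (f : X ⟶ Y) (a b : Subobject Y),
    (Subobject.pullback f).obj (sup a b) =
      sup ((Subobject.pullback f).obj a) ((Subobject.pullback f).obj b)
  bot_pullback : ∀ {X Y : C} (f : X ⟶ Y),
    (Subobject.pullback f).obj (bot Y) = bot X

/-- The image of a subobject along an arbitrary morphism, computed using the
effective epi–mono factorizations of a coherent category. -/
noncomputable def CoherentData.img {C : Type u} [Category.{v} C] [HasFiniteLimits C]
    (hC : CoherentData C) {X Y : C} (f : X ⟶ Y) (a : Subobject X) : Subobject Y :=
  mkSub (hC.factor ((a.arrow : (a : C) ⟶ X) ≫ f)).choose_spec.choose_spec.choose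
    (hC.factor ((a.arrow : (a : C) ⟶ X) ≫ f)).choose_spec.choose_spec.choose_spec.2.1

/-- A functor between coherent categories is *coherent* if it preserves finite
limits, effective epimorphisms, finite unions of subobjects and the least
subobjects. -/
structure IsCoherent {C : Type u} [Category.{v} C] {D : Type u'} [Category.{v'} D]
    [HasFiniteLimits C] [HasFiniteLimits D]
    (hC : CoherentData C) (hD : CoherentData D) (F : C ⥤ D) : Prop where
  presLim : Nonempty (PreservesFiniteLimits F)
  presMono : PreservesMono F
  presEpi : ∀ ⦃X Y : C⦄ (f : X ⟶ Y), EffectiveEpi f → EffectiveEpi (F.map f)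
  map_sup : ∀ {X : C} (a b : Subobject X),
    mapSub F presMono (hC.sup a b) = hD.sup (mapSub F presMono a) (mapSub F presMono b)
  map_bot : ∀ X : C, mapSub F presMono (hC.bot X) = hD.bot (F.obj X)

/-- Two functors are *elementarily equivalent* if they validate the same
inclusions of subobjects. -/
def ElemEquiv [HasFiniteLimits C] [HasFiniteLimits D] (M N : C ⥤ D)
    (hM : PreservesMono M) (hN : PreservesMono N) : Prop :=
  ∀ (x : C) (a b : Subobject x),
    (mapSub M hM a ≤ mapSub M hM b) ↔ (mapSub N hN a ≤ mapSub N hN b)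

/-- Membership of an element in a subobject of a set. -/
def memSub {X : Type w} (S : Subobject X) (a : X) : Prop :=
  ∃ b : (S : Type w), S.arrow b = a

/-- A `Set`-valued coherent functor is *positively closed* if every element not
belonging to a subobject belongs to one disjoint from it. -/
def PositivelyClosed {C : Type u} [Category.{v} C] [HasFiniteLimits C]
    (hC : CoherentData C) (M : C ⥤ Type w) (hM : PreservesMono M) : Prop :=
  ∀ (x : C) (u : Subobject x) (a : M.obj x), ¬ memSub (mapSub M hM u) a →
    ∃ v : Subobject x, u ⊓ v = hC.bot x ∧ memSub (mapSub M hM v) a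

section Degenerate

variable {C : Type u} [Category.{v} C] [HasFiniteLimits C] (hC : CoherentData C)

/-- An object of a coherent category is *degenerate* if its least subobject is the whole object. -/
def CoherentData.Degenerate (A : C) : Prop := hC.bot A = ⊤

variable {hC}

theorem CoherentData.degenerate_iff_factors_bot {A X : C} (f : A ⟶ X) :
    hC.Degenerate A ↔ (hC.bot X).Factors f := by
  have hpb := Subobject.isPullback f (hC.bot X)
  have hbot := hC.bot_pullback f
  constructor
  · intro h
    have : IsIso ((Subobject.pullback f).obj (hC.bot X)).arrow :=
      (Subobject.isIso_arrow_iff_eq_top _).2 (hbot.trans h)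
    have hf : (inv ((Subobject.pullback f).obj (hC.bot X)).arrow ≫
        Subobject.pullbackπ f (hC.bot X)) ≫ (hC.bot X).arrow = f := by
      rw [Category.assoc, IsIso.inv_comp_eq]
      exact hpb.w
    exact hf ▸ Subobject.factors_comp_arrow _
  · intro h
    obtain ⟨s, hs⟩ : ∃ s : A ⟶ (((Subobject.pullback f).obj (hC.bot X) :) : C),
        s ≫ ((Subobject.pullback f).obj (hC.bot X)).arrow = 𝟙 A :=
      ⟨hpb.lift ((hC.bot X).factorThru f h) (𝟙 A) (by simp), by simp⟩
    rw [CoherentData.Degenerate, ← hbot]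
    exact top_le_iff.1 (Subobject.le_of_comm ((⊤ : Subobject A).arrow ≫ s) (by simp [hs]))

theorem CoherentData.Degenerate.of_hom {A B : C} (h : hC.Degenerate A) (f : B ⟶ A) :
    hC.Degenerate B := by
  rw [CoherentData.Degenerate, ← hC.bot_pullback f, show hC.bot A = ⊤ from h,
    Subobject.pullback_top]

theorem CoherentData.Degenerate.of_effectiveEpi {A B : C} (h : hC.Degenerate B) (e : B ⟶ A)
    [EffectiveEpi e] : hC.Degenerate A := by
  have hf := (CoherentData.degenerate_iff_factors_bot e).1 h
  have sq : CommSq ((hC.bot A).factorThru e hf) e (hC.bot A).arrow (𝟙 A) := ⟨by simp⟩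
  exact top_le_iff.1 (Subobject.le_of_comm ((⊤ : Subobject A).arrow ≫ sq.lift) (by simp))

theorem CoherentData.eq_bot_of_degenerate {X : C} (u : Subobject X) (h : hC.Degenerate (u : C)) :
    u = hC.bot X := by
  refine le_antisymm ?_ (hC.bot_le u)
  have hf := (CoherentData.degenerate_iff_factors_bot u.arrow).1 h
  exact Subobject.le_of_comm ((hC.bot X).factorThru _ hf) (by simp)

theorem CoherentData.pullback_eq_bot {X : C} {u v : Subobject X} (h : u ⊓ v = hC.bot X) :
    (Subobject.pullback v.arrow).obj u = hC.bot (v : C) := by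
  refine CoherentData.eq_bot_of_degenerate _ ((CoherentData.degenerate_iff_factors_bot
    (((Subobject.pullback v.arrow).obj u).arrow ≫ v.arrow)).2 ?_)
  rw [← h, Subobject.inf_factors]
  refine ⟨?_, Subobject.factors_comp_arrow _⟩
  rw [← (Subobject.isPullback v.arrow u).w]
  exact Subobject.factors_comp_arrow _

/-- The image of a morphism whose pullback along a subobject is degenerate is disjoint from that
subobject. -/
theorem CoherentData.exists_disjoint_factors {A X : C} (f : A ⟶ X) (u : Subobject X)
    (h : hC.Degenerate (pullback f u.arrow)) :
    ∃ v : Subobject X, u ⊓ v = hC.bot X ∧ v.Factors f := by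
  obtain ⟨Z, e, m, he, hm, rfl⟩ := hC.factor f
  refine ⟨Subobject.mk m, CoherentData.eq_bot_of_degenerate _ ?_,
    (Subobject.mk_factors_iff _ _).2 ⟨e, rfl⟩⟩
  let q : pullback (e ≫ m) u.arrow ⟶ pullback m u.arrow :=
    pullback.lift (pullback.fst _ _ ≫ e) (pullback.snd _ _) (by simp [pullback.condition])
  have hq : IsPullback q (pullback.fst _ _) (pullback.fst m u.arrow) e :=
    IsPullback.of_right (h₁₂ := pullback.snd m u.arrow) (v₁₃ := u.arrow) (h₂₂ := m)
      (by rw [show q ≫ pullback.snd m u.arrow = _ from pullback.lift_snd _ _ _]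
          exact (IsPullback.of_hasPullback (e ≫ m) u.arrow).flip)
      (pullback.lift_fst _ _ _) (IsPullback.of_hasPullback m u.arrow).flip
  have : EffectiveEpi q := hC.effectiveEpi_pullback _ _ _ _ hq he
  have hd : hC.Degenerate (pullback m u.arrow) := h.of_effectiveEpi q
  refine hd.of_hom (pullback.lift ((Subobject.ofLE _ _ inf_le_right) ≫
    (Subobject.underlyingIso m).hom) (Subobject.ofLE _ _ inf_le_left) (by simp))

theorem CoherentData.subobject_eq_top (h : hC.Degenerate (⊤_ C)) {X : C} (u : Subobject X) :
    u = ⊤ :=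
  top_le_iff.1 ((show hC.bot X = ⊤ from h.of_hom (terminal.from X)) ▸ hC.bot_le u)

theorem CoherentData.isIso_of_mono (h : hC.Degenerate (⊤_ C)) {X Y : C} (f : X ⟶ Y) [Mono f] :
    IsIso f :=
  (Subobject.isIso_iff_mk_eq_top f).2 (CoherentData.subobject_eq_top h _)

theorem CoherentData.equiv_punit_of_degenerate (h : hC.Degenerate (⊤_ C)) :
    Nonempty (C ≌ Discrete PUnit.{w + 1}) := by
  have hsub : ∀ {X Y : C} (f g : X ⟶ Y), f = g := fun f g => by
    have := CoherentData.isIso_of_mono h (equalizer.ι f g)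
    exact eq_of_epi_equalizer
  have hiso : ∀ X : C, IsIso (terminal.from X) := fun X => by
    have : Mono (terminal.from X) := ⟨fun _ _ _ => hsub _ _⟩
    exact CoherentData.isIso_of_mono h _
  refine (equiv_punit_iff_unique C).2
    ⟨⟨⊤_ C⟩, fun X Y => ⟨⟨⟨terminal.from X ≫ inv (terminal.from Y)⟩, fun _ => hsub _ _⟩⟩⟩

end Degenerate

section SetValued

theorem memSub_mk {A X : Type w} (f : A ⟶ X) [Mono f] (a : X) :
    memSub (Subobject.mk f) a ↔ ∃ b, f b = a := by
  constructor
  · rintro ⟨b, rfl⟩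
    exact ⟨(Subobject.underlyingIso f).hom b, by
      rw [← comp_apply, Subobject.underlyingIso_hom_comp_eq_mk]⟩
  · rintro ⟨b, rfl⟩
    exact ⟨(Subobject.underlyingIso f).inv b, by
      rw [← comp_apply, Subobject.underlyingIso_arrow]⟩

theorem le_iff_memSub {X : Type w} (S T : Subobject X) :
    S ≤ T ↔ ∀ a, memSub S a → memSub T a := by
  constructor
  · rintro h _ ⟨b, rfl⟩
    exact ⟨Subobject.ofLE S T h b, by rw [← comp_apply, Subobject.ofLE_arrow]⟩
  · intro h
    choose g hg using fun b : (S : Type w) => h (S.arrow b) ⟨b, rfl⟩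
    exact Subobject.le_of_comm (↾g) (by ext b; exact hg b)

theorem memSub_mapSub {C : Type u} [Category.{v} C] {M : C ⥤ Type w} (hM : PreservesMono M)
    {X : C} (u : Subobject X) (a : M.obj X) :
    memSub (mapSub M hM u) a ↔ ∃ b, M.map u.arrow b = a := by
  have := hM u.arrow inferInstance
  exact memSub_mk (M.map u.arrow) a

theorem memSub_mapSub_mono {C : Type u} [Category.{v} C] {M : C ⥤ Type w} (hM : PreservesMono M)
    {X : C} {u v : Subobject X} (h : u ≤ v) {a : M.obj X} (ha : memSub (mapSub M hM u) a) :
    memSub (mapSub M hM v) a := by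
  rw [memSub_mapSub] at *
  obtain ⟨b, rfl⟩ := ha
  exact ⟨M.map (Subobject.ofLE u v h) b, by
    rw [← comp_apply, ← M.map_comp, Subobject.ofLE_arrow]⟩

theorem memSub_mapSub_pullback {C : Type u} [Category.{v} C] [HasPullbacks C] {M : C ⥤ Type w}
    (hlim : PreservesLimitsOfShape WalkingCospan M) (hM : PreservesMono M) {X Y : C} (f : X ⟶ Y)
    {u : Subobject Y} {a : M.obj X} (ha : memSub (mapSub M hM u) (M.map f a)) :
    memSub (mapSub M hM ((Subobject.pullback f).obj u)) a := by
  rw [memSub_mapSub] at *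
  obtain ⟨b, hb⟩ := ha
  obtain ⟨c, -, hc⟩ := Types.exists_of_isPullback ((Subobject.isPullback f u).map M) b a hb
  exact ⟨c, hc⟩

theorem effectiveEpi_of_surjective {X Y : Type w} (f : X ⟶ Y) (hf : Function.Surjective f) :
    EffectiveEpi f := by
  have : IsSplitEpi f := ⟨⟨⟨↾(Function.surjInv hf), by
    ext y; exact Function.surjInv_eq hf y⟩⟩⟩
  infer_instance

end SetValued

section Names

variable (C : Type v) [SmallCategory C]

/-- Formal names of elements of a model: a name of sort `Y` records finitely many previously named
elements, which are to be the values of given morphisms out of `Y` at the new element. -/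
inductive Name : C → Type v
  | mk {n : ℕ} {X : Fin n → C} (par : ∀ i, Name (X i)) {Y : C} (f : ∀ i, Y ⟶ X i) : Name Y

/-- A name together with its sort. -/
abbrev Node := Σ X : C, Name C X

variable {C}

/-- `Link k j φ` says that the name `k` prescribes `j` as its value under `φ`. -/
inductive Link : (k j : Node C) → (k.1 ⟶ j.1) → Prop
  | mk {n : ℕ} {X : Fin n → C} (par : ∀ i, Name C (X i)) {Y : C} (f : ∀ i, Y ⟶ X i) (i : Fin n) :
    Link ⟨Y, .mk par f⟩ ⟨X i, par i⟩ (f i)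

theorem finite_link (k : Node C) : {p : Σ j : Node C, k.1 ⟶ j.1 | Link k p.1 p.2}.Finite := by
  obtain ⟨Y, ⟨par, f⟩⟩ := k
  refine (Set.finite_range fun i => (⟨⟨_, par i⟩, f i⟩ : Σ j : Node C, Y ⟶ j.1)).subset ?_
  rintro ⟨j, φ⟩ h
  cases h with
  | mk _ _ i => exact ⟨i, rfl⟩

/-- An interpretation of a finite set of names by generalized elements at stage `A`. -/
structure Assignment (F : Finset (Node C)) (A : C) where
  val : ∀ k ∈ F, A ⟶ k.1
  val_comp : ∀ {k j : Node C} {φ : k.1 ⟶ j.1} (hk : k ∈ F) (hj : j ∈ F), Link k j φ →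
    val k hk ≫ φ = val j hj

variable [HasFiniteLimits C]

theorem exists_universal_assignment (F : Finset (Node C)) :
    ∃ (L : C) (p : Assignment F L),
      (∀ {A : C} (a : Assignment F A), ∃ h : A ⟶ L, ∀ k hk, h ≫ p.val k hk = a.val k hk) ∧
      ∀ {A : C} (g h : A ⟶ L), (∀ k hk, g ≫ p.val k hk = h ≫ p.val k hk) → g = h := by
  let E := Σ k j : F, {φ : k.1.1 ⟶ j.1.1 // Link k.1 j.1 φ}
  have (k j : F) : Finite {φ : k.1.1 ⟶ j.1.1 // Link k.1 j.1 φ} :=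
    have := (finite_link k.1).to_subtype
    Finite.of_injective
      (β := {p : Σ j : Node C, k.1.1 ⟶ j.1 | Link k.1 p.1 p.2})
      (fun φ => ⟨⟨j.1, φ.1⟩, φ.2⟩) fun φ ψ h => by
        ext
        simpa using h
  have : Finite E := inferInstance
  let P : C := ∏ᶜ fun k : F => k.1.1
  let W : C := ∏ᶜ fun e : E => e.2.1.1.1
  let l : P ⟶ W := Pi.lift fun e => Pi.π (fun k : F => k.1.1) e.1 ≫ e.2.2.1
  let r : P ⟶ W := Pi.lift fun e => Pi.π (fun k : F => k.1.1) e.2.1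
  refine ⟨equalizer l r,
    ⟨fun k hk => equalizer.ι l r ≫ Pi.π (fun k : F => k.1.1) ⟨k, hk⟩, ?_⟩, ?_, ?_⟩
  · intro k j φ hk hj hφ
    have := equalizer.condition l r =≫ Pi.π (fun e : E => e.2.1.1.1) ⟨⟨k, hk⟩, ⟨j, hj⟩, ⟨φ, hφ⟩⟩
    simpa [l, r] using this
  · intro A a
    refine ⟨equalizer.lift (Pi.lift fun k : F => a.val k.1 k.2) ?_, ?_⟩
    · refine Pi.hom_ext _ _ fun e => ?_
      simpa [l, r] using a.val_comp e.1.2 e.2.1.2 e.2.2.2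
    · intro k hk
      simp
  · intro A g h hgh
    refine equalizer.hom_ext (Pi.hom_ext _ _ fun k => ?_)
    simpa using hgh k.1 k.2

/-- The object classifying the interpretations of a finite set of names. -/
noncomputable def classifier (F : Finset (Node C)) : C :=
  (exists_universal_assignment F).choose

/-- The universal interpretation of a finite set of names. -/
noncomputable def univ (F : Finset (Node C)) : Assignment F (classifier F) :=
  (exists_universal_assignment F).choose_spec.choose

theorem exists_classifying_hom {F : Finset (Node C)} {A : C} (a : Assignment F A) :
    ∃ h : A ⟶ classifier F, ∀ k hk, h ≫ (univ F).val k hk = a.val k hk :=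
  (exists_universal_assignment F).choose_spec.choose_spec.1 a

theorem classifier_hom_ext {F : Finset (Node C)} {A : C} {g h : A ⟶ classifier F}
    (H : ∀ k hk, g ≫ (univ F).val k hk = h ≫ (univ F).val k hk) : g = h :=
  (exists_universal_assignment F).choose_spec.choose_spec.2 g h H

/-- The projection forgetting the interpretation of some names. -/
noncomputable def restrict {F G : Finset (Node C)} (h : F ⊆ G) : classifier G ⟶ classifier F :=
  (exists_classifying_hom ⟨fun k hk => (univ G).val k (h hk),
    fun hk hj => (univ G).val_comp (h hk) (h hj)⟩).choose

@[simp]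
theorem restrict_val {F G : Finset (Node C)} (h : F ⊆ G) (k : Node C) (hk : k ∈ F) :
    restrict h ≫ (univ F).val k hk = (univ G).val k (h hk) :=
  (exists_classifying_hom ⟨fun k hk => (univ G).val k (h hk),
    fun hk hj => (univ G).val_comp (h hk) (h hj)⟩).choose_spec k hk

/-- The pro-object of interpretations of finite subsets of a set of names. -/
noncomputable def classifierFunctor (S : Set (Node C)) :
    {F : Finset (Node C) // ↑F ⊆ S} ⥤ Cᵒᵖ where
  obj F := .op (classifier F.1)
  map h := (restrict (leOfHom h)).op
  map_id F := Quiver.Hom.unop_inj (classifier_hom_ext fun k hk => by simp)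
  map_comp f g := Quiver.Hom.unop_inj (classifier_hom_ext fun k hk => by simp)

/-- The name of an element of `Y` lying over the tuple of elements named by `F`. -/
noncomputable def nodeOver (F : Finset (Node C)) {Y : C} (f : Y ⟶ classifier F) : Node C :=
  ⟨Y, .mk (fun i => (F.equivFin.symm i).1.2)
    fun i => f ≫ (univ F).val (F.equivFin.symm i).1 (F.equivFin.symm i).2⟩

theorem link_nodeOver_iff {F : Finset (Node C)} {Y : C} (f : Y ⟶ classifier F) {j : Node C}
    {φ : Y ⟶ j.1} : Link (nodeOver F f) j φ ↔ ∃ hj : j ∈ F, φ = f ≫ (univ F).val j hj := by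
  constructor
  · intro h
    cases h with
    | mk _ _ i => exact ⟨(F.equivFin.symm i).2, rfl⟩
  · rintro ⟨hj, rfl⟩
    obtain ⟨i, hi⟩ := F.equivFin.symm.surjective ⟨j, hj⟩
    obtain rfl : (F.equivFin.symm i).1 = j := congrArg Subtype.val hi
    exact Link.mk _ _ i

variable (hC : CoherentData C)

/-- A set of names is *consistent* if it contains the names its members refer to and its finite
subsets can be interpreted in a nondegenerate way. -/
def Consistent (S : Set (Node C)) : Prop :=
  (∀ ⦃k j : Node C⦄ ⦃φ : k.1 ⟶ j.1⦄, Link k j φ → k ∈ S → j ∈ S) ∧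
    ∀ F : Finset (Node C), ↑F ⊆ S → ¬ hC.Degenerate (classifier F)

variable {hC}

theorem consistent_empty (h : ¬ hC.Degenerate (⊤_ C)) : Consistent hC ∅ := by
  refine ⟨fun _ _ _ _ h => h, fun F hF hdeg => h ?_⟩
  have hk : ∀ k : Node C, k ∉ F := fun k hk => hF hk
  obtain ⟨g, -⟩ := exists_classifying_hom (F := F) (A := ⊤_ C)
    ⟨fun k h => (hk k h).elim, fun h => (hk _ h).elim⟩
  exact hdeg.of_hom g

theorem exists_maximal_consistent (h : ¬ hC.Degenerate (⊤_ C)) :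
    ∃ S : Set (Node C), Maximal (Consistent hC) S := by
  have key : ∀ c ⊆ {S | Consistent hC S}, IsChain (· ⊆ ·) c → c.Nonempty →
      ∃ ub ∈ {S | Consistent hC S}, ∀ s ∈ c, s ⊆ ub := by
    intro c hc hchain hne
    refine ⟨⋃₀ c, ⟨fun k j φ hl ⟨s, hs, hk⟩ => ⟨s, hs, (hc hs).1 hl hk⟩, fun F hF => ?_⟩,
      fun s hs => Set.subset_sUnion_of_mem hs⟩
    obtain ⟨s, hs, hFs⟩ := hchain.directedOn.exists_mem_subset_of_finset_subset_biUnion hne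
      (f := id) (s := F) (by simpa [Set.sUnion_eq_biUnion] using hF)
    exact (hc hs).2 F hFs
  obtain ⟨S, -, hS⟩ := zorn_subset_nonempty _ key ∅ (consistent_empty h)
  exact ⟨S, hS⟩

open Classical in
theorem nodeOver_mem_or_degenerate {S : Set (Node C)} (hS : Maximal (Consistent hC) S)
    {F : Finset (Node C)} (hF : ↑F ⊆ S) {Y : C} (f : Y ⟶ classifier F) :
    nodeOver F f ∈ S ∨ ∃ (G : Finset (Node C)) (hFG : F ⊆ G), ↑G ⊆ S ∧
      hC.Degenerate (pullback f (restrict hFG)) := by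
  by_contra! ⟨hk, H⟩
  set k := nodeOver F f
  refine hk (hS.2 (y := insert k S) ⟨?_, fun G hG hdeg => ?_⟩ (Set.subset_insert _ _)
    (Set.mem_insert _ _))
  · rintro i j φ hl (rfl | hi)
    · obtain ⟨hj, -⟩ := (link_nodeOver_iff f).1 hl
      exact .inr (hF hj)
    · exact .inr (hS.1.1 hl hi)
  · have hG' : ∀ j ∈ G, j ≠ k → j ∈ S := fun j hj hne => (hG hj).resolve_left hne
    have hFG : F ⊆ G.erase k ∪ F := Finset.subset_union_right
    have hsub : ↑(G.erase k ∪ F) ⊆ S := by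
      intro j hj
      rcases Finset.mem_union.1 hj with hj | hj
      · exact hG' j (Finset.mem_of_mem_erase hj) (Finset.ne_of_mem_erase hj)
      · exact hF hj
    refine H _ hFG hsub ?_
    let val : ∀ j ∈ G, pullback f (restrict hFG) ⟶ j.1 := fun j hj =>
      if h : j = k then pullback.fst _ _ ≫ eqToHom (by rw [h]; rfl)
      else pullback.snd _ _ ≫ (univ _).val j
        (Finset.mem_union_left _ (Finset.mem_erase.2 ⟨h, hj⟩))
    suffices hval : ∀ {i j : Node C} {φ : i.1 ⟶ j.1} (hi : i ∈ G) (hj : j ∈ G), Link i j φ →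
        val i hi ≫ φ = val j hj by
      obtain ⟨g, -⟩ := exists_classifying_hom (F := G) ⟨val, hval⟩
      exact hdeg.of_hom g
    intro i j φ hi hj hl
    have hjk : j ≠ k := by
      rintro rfl
      by_cases hik : i = nodeOver F f
      · subst hik
        exact hk (hF ((link_nodeOver_iff f).1 hl).1)
      · exact hk (hS.1.1 hl (hG' i hi hik))
    by_cases hik : i = k
    · subst hik
      obtain ⟨hjF, rfl⟩ := (link_nodeOver_iff f).1 hl
      have h1 : val k hi = pullback.fst f (restrict hFG) :=
        (dif_pos rfl).trans (Category.comp_id _)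
      have h2 : val j hj = pullback.snd f (restrict hFG) ≫ (univ _).val j (hFG hjF) :=
        dif_neg hjk
      rw [h1, h2, ← restrict_val hFG j hjF]
      refine (Category.assoc _ _ _).symm.trans (Eq.trans ?_ (Category.assoc _ _ _))
      exact congrArg (· ≫ (univ F).val j hjF) pullback.condition
    · simp only [val, dif_neg hik, dif_neg hjk, Category.assoc]
      rw [(univ _).val_comp _ _ hl]

open Classical in
/-- A nondegenerate coherent category has a nondegenerate pro-object for which every lifting
problem is either solvable or refuted at some stage. -/
theorem exists_generic_proobject (h : ¬ hC.Degenerate (⊤_ C)) :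
    ∃ (J : Type v) (_ : SemilatticeSup J) (_ : Nonempty J) (D : J ⥤ Cᵒᵖ),
      (∀ j, ¬ hC.Degenerate (D.obj j).unop) ∧
      ∀ (j : J) {Y : C} (f : Y ⟶ (D.obj j).unop),
        (∃ (k : J) (a : j ⟶ k) (y : (D.obj k).unop ⟶ Y), y ≫ f = (D.map a).unop) ∨
        ∃ (k : J) (a : j ⟶ k), hC.Degenerate (pullback f (D.map a).unop) := by
  obtain ⟨S, hS⟩ := exists_maximal_consistent h
  refine ⟨{F : Finset (Node C) // ↑F ⊆ S}, Subtype.semilatticeSup fun F G hF hG => ?_, ⟨⟨∅, by simp⟩⟩,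
    classifierFunctor S, fun F => hS.1.2 F.1 F.2, fun F Y f => ?_⟩
  · simpa using And.intro hF hG
  · rcases nodeOver_mem_or_degenerate hS F.2 f with hk | ⟨G, hFG, hG, hdeg⟩
    · left
      have hsub : F.1 ⊆ insert (nodeOver F.1 f) F.1 := Finset.subset_insert _ _
      refine ⟨⟨insert (nodeOver F.1 f) F.1, by simpa [Set.insert_subset_iff] using ⟨hk, F.2⟩⟩,
        homOfLE hsub, (univ _).val (nodeOver F.1 f) (Finset.mem_insert_self _ _), ?_⟩
      refine classifier_hom_ext fun j hj => ?_
      refine Eq.trans ?_ (restrict_val hsub j hj).symm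
      refine (Category.assoc _ _ _).trans ?_
      exact (univ _).val_comp _ _ ((link_nodeOver_iff f).2 ⟨hj, rfl⟩)
    · exact .inr ⟨⟨G, hG⟩, homOfLE hFG, hdeg⟩

end Names

section Model

variable {C : Type v} [SmallCategory C] {J : Type v} [SmallCategory J]

/-- The set-valued functor pro-represented by a diagram. -/
noncomputable def proHom (D : J ⥤ Cᵒᵖ) : C ⥤ Type v :=
  (D ⋙ coyoneda).flip ⋙ colim

/-- The element of `proHom D` represented by a morphism. -/
noncomputable def proHom.mk (D : J ⥤ Cᵒᵖ) {X : C} (j : J) (f : (D.obj j).unop ⟶ X) :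
    (proHom D).obj X :=
  colimit.ι ((D ⋙ coyoneda).flip.obj X) j f

theorem proHom.exists_rep (D : J ⥤ Cᵒᵖ) {X : C} (a : (proHom D).obj X) :
    ∃ (j : J) (f : (D.obj j).unop ⟶ X), proHom.mk D j f = a :=
  Types.jointly_surjective' (F := (D ⋙ coyoneda).flip.obj X) a

theorem proHom.map_mk (D : J ⥤ Cᵒᵖ) {X Y : C} (g : X ⟶ Y) (j : J) (f : (D.obj j).unop ⟶ X) :
    (proHom D).map g (proHom.mk D j f) = proHom.mk D j (f ≫ g) :=
  colimit.ι_map_apply ((D ⋙ coyoneda).flip.map g) j f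

theorem proHom.mk_map_comp (D : J ⥤ Cᵒᵖ) {X : C} {j k : J} (a : j ⟶ k)
    (f : (D.obj j).unop ⟶ X) : proHom.mk D k ((D.map a).unop ≫ f) = proHom.mk D j f :=
  colimit.w_apply ((D ⋙ coyoneda).flip.obj X) a f

theorem proHom.preservesFiniteLimits [HasFiniteLimits C] [IsFiltered J] (D : J ⥤ Cᵒᵖ) :
    PreservesFiniteLimits (proHom D) := by
  have : PreservesFiniteLimits (D ⋙ coyoneda).flip :=
    ⟨fun K _ _ => preservesLimitsOfShape_of_evaluation _ _ fun j =>
      inferInstanceAs (PreservesLimitsOfShape K (coyoneda.obj (D.obj j)))⟩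
  exact comp_preservesFiniteLimits _ _

variable [HasFiniteLimits C] {hC : CoherentData C}

/-- A finite-limit-preserving functor to sets without elements of least subobjects, turning
effective epimorphisms into surjections and positively closed, is coherent. -/
theorem isCoherent_of_positivelyClosed (hT : CoherentData (Type v)) {M : C ⥤ Type v}
    (hlim : PreservesFiniteLimits M) (hM : PreservesMono M)
    (hepi : ∀ ⦃X Y : C⦄ (f : X ⟶ Y), EffectiveEpi f → Function.Surjective (M.map f))
    (hbot : ∀ (X : C) (a : M.obj X), ¬ memSub (mapSub M hM (hC.bot X)) a)
    (hpos : PositivelyClosed hC M hM) : IsCoherent hC hT M where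
  presLim := ⟨hlim⟩
  presMono := hM
  presEpi X Y f hf := effectiveEpi_of_surjective _ (hepi f hf)
  map_sup {X} u v := by
    refine le_antisymm ((le_iff_memSub _ _).2 fun a ha => ?_)
      (hT.sup_le ((le_iff_memSub _ _).2 fun a => memSub_mapSub_mono hM (hC.le_sup_left u v))
        ((le_iff_memSub _ _).2 fun a => memSub_mapSub_mono hM (hC.le_sup_right u v)))
    by_cases hu : memSub (mapSub M hM u) a
    · exact (le_iff_memSub _ _).1 (hT.le_sup_left _ _) a hu
    obtain ⟨w, huw, haw⟩ := hpos X u a hu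
    obtain ⟨b, rfl⟩ := (memSub_mapSub hM w a).1 haw
    have hb := memSub_mapSub_pullback inferInstance hM w.arrow ha
    rw [hC.sup_pullback, CoherentData.pullback_eq_bot huw] at hb
    obtain ⟨c, rfl⟩ := (memSub_mapSub hM _ b).1
      (memSub_mapSub_mono hM (hC.sup_le (hC.bot_le _) le_rfl) hb)
    refine (le_iff_memSub _ _).1 (hT.le_sup_right _ _) _ ((memSub_mapSub hM v _).2
      ⟨M.map (Subobject.pullbackπ w.arrow v) c, ?_⟩)
    rw [← comp_apply, ← comp_apply, ← M.map_comp, ← M.map_comp,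
      (Subobject.isPullback w.arrow v).w]
  map_bot X := le_antisymm ((le_iff_memSub _ _).2 fun a ha => (hbot X a ha).elim) (hT.bot_le _)

theorem exists_positivelyClosed_of_not_degenerate (hT : CoherentData (Type v))
    (h : ¬ hC.Degenerate (⊤_ C)) :
    ∃ (M : C ⥤ Type v) (hM : IsCoherent hC hT M), PositivelyClosed hC M hM.presMono := by
  obtain ⟨J, _, _, D, hD, hgen⟩ := exists_generic_proobject h
  have hlim := proHom.preservesFiniteLimits D
  have hM : PreservesMono (proHom D) := fun _ _ f _ => inferInstance
  have hpos : PositivelyClosed hC (proHom D) hM := by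
    intro X u a ha
    rw [memSub_mapSub] at ha
    obtain ⟨j, x, rfl⟩ := proHom.exists_rep D a
    rcases hgen j (pullback.fst x u.arrow) with ⟨k, α, y, hy⟩ | ⟨k, α, hdeg⟩
    · refine (ha ⟨proHom.mk D k (y ≫ pullback.snd x u.arrow), ?_⟩).elim
      rw [proHom.map_mk, Category.assoc, ← pullback.condition, ← Category.assoc, hy,
        proHom.mk_map_comp]
    · let x' := (D.map α).unop ≫ x
      obtain ⟨v, hv, hxv⟩ := CoherentData.exists_disjoint_factors x' u
        (hdeg.of_hom (pullback.lift
          (pullback.lift (pullback.fst _ _ ≫ (D.map α).unop) (pullback.snd x' u.arrow)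
            (by simp [← pullback.condition, x'])) (pullback.fst x' u.arrow)
          (pullback.lift_fst _ _ _)))
      refine ⟨v, hv, (memSub_mapSub hM v _).2 ⟨proHom.mk D k (v.factorThru x' hxv), ?_⟩⟩
      rw [proHom.map_mk, Subobject.factorThru_arrow, proHom.mk_map_comp]
  refine ⟨proHom D, isCoherent_of_positivelyClosed hT hlim hM ?_ ?_ hpos, hpos⟩
  · intro X Y f hf b
    obtain ⟨j, y, rfl⟩ := proHom.exists_rep D b
    rcases hgen j (pullback.fst y f) with ⟨k, α, z, hz⟩ | ⟨k, α, hdeg⟩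
    · refine ⟨proHom.mk D k (z ≫ pullback.snd y f), ?_⟩
      rw [proHom.map_mk, Category.assoc, ← pullback.condition, ← Category.assoc, hz,
        proHom.mk_map_comp]
    · have h1 := hC.effectiveEpi_pullback _ _ _ _ (IsPullback.of_hasPullback y f) hf
      have h2 := hC.effectiveEpi_pullback _ _ _ _
        (IsPullback.of_hasPullback (pullback.fst y f) (D.map α).unop).flip h1
      exact (hD k (hdeg.of_effectiveEpi (pullback.snd _ (D.map α).unop))).elim
  · intro X a ha
    rw [memSub_mapSub] at ha
    obtain ⟨b, -⟩ := ha
    obtain ⟨j, x, -⟩ := proHom.exists_rep D b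
    refine hD j ?_
    rw [CoherentData.degenerate_iff_factors_bot (x ≫ (hC.bot X).arrow)]
    exact Subobject.factors_comp_arrow x

end Model

/-- For every small coherent category `C` not equivalent to the terminal
category there exists a positively closed coherent functor `M : C ⥤ Type`. -/
theorem exists_positivelyClosed (C : Type v) [SmallCategory C] [HasFiniteLimits C]
    (hC : CoherentData C) (hT : CoherentData (Type v))
    (hnt : ¬ Nonempty (C ≌ Discrete PUnit.{v + 1})) :
    ∃ (M : C ⥤ Type v) (hM : IsCoherent hC hT M), PositivelyClosed hC M hM.presMono :=
  exists_positivelyClosed_of_not_degenerate hT fun h =>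
    hnt (CoherentData.equiv_punit_of_degenerate h)

end PosModel
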